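/- For every τ ∈ ℍ: (1/(2πi))·t′(τ) = 2t(τ)² − x(τ)y(τ)/32; equivalently, with A(τ) = −4π²t(τ), one has πi·A′(τ) = A(τ)² − (π⁴/4)·x(τ)y(τ). -/

import Mathlib

open Complex

noncomputable section

/-- The theta constant `θ(τ) = ∑_{n ∈ ℤ} exp(πin²τ)`. -/
def theta (τ : ℂ) : ℂ := ∑' n : ℤ, Complex.exp (Real.pi * Complex.I * (n : ℂ) ^ 2 * τ)

/-- `θ₂(τ) = ∑_{n ∈ ℤ} exp(πi(n+1/2)²τ)`. -/
def theta2 (τ : ℂ) : ℂ := ∑' n : ℤ, Complex.exp (Real.pi * Complex.I * ((n : ℂ) + 1/2) ^ 2 * τ)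

/-- `θ₄(τ) = ∑_{n ∈ ℤ} (-1)ⁿ exp(πin²τ)`. -/
def theta4 (τ : ℂ) : ℂ :=
  ∑' n : ℤ, (-1 : ℂ) ^ n * Complex.exp (Real.pi * Complex.I * (n : ℂ) ^ 2 * τ)

/-- `x(τ) = -θ₄(τ)⁴`. -/
def xx (τ : ℂ) : ℂ := -(theta4 τ) ^ 4

/-- `y(τ) = θ₂(τ)⁴`. -/
def yy (τ : ℂ) : ℂ := (theta2 τ) ^ 4

/-- `t(τ) = (1/(2πi)) θ'(τ)/θ(τ)`. -/
def tt (τ : ℂ) : ℂ := deriv theta τ / (2 * Real.pi * Complex.I * theta τ)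

/-- `A(τ) = -4π² t(τ)`. -/
def AA (τ : ℂ) : ℂ := -4 * (Real.pi : ℂ) ^ 2 * tt τ


open Filter Topology Asymptotics UpperHalfPlane ModularForm
open scoped MatrixGroups Manifold Real

lemma aux_denom_T (z : ℍ) : denom ModularGroup.T z = 1 := by
  rw [ModularGroup.denom_apply]
  simp [ModularGroup.T]

lemma aux_DT (z : ℍ) : discriminant (ModularGroup.T • z) = discriminant z := by
  have := congrFun discriminant_T_invariant z
  rw [SL_slash_apply, aux_denom_T, one_zpow, mul_one] at this
  exact this

lemma aux_DS (z : ℍ) :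
    discriminant (ModularGroup.S • z) = (z : ℂ) ^ 12 * discriminant z := by
  have := congrFun discriminant_S_invariant z
  rw [SL_slash_apply, ModularGroup.denom_S] at this
  have hz := z.ne_zero
  have e : (z : ℂ) ^ (-12 : ℤ) = ((z : ℂ) ^ 12)⁻¹ := by
    rw [zpow_neg]; congr 1
  rw [e] at this
  rw [← this, mul_comm, mul_assoc, inv_mul_cancel₀ (pow_ne_zero _ hz), mul_one]

lemma aux_levelOne (n : ℕ) (P : ℂ → ℂ) (c : ℂ)
    (hd : DifferentiableOn ℂ P {z : ℂ | 0 < z.im})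
    (hT : ∀ z : ℂ, 0 < z.im → P (z + 1) = P z)
    (hS : ∀ z : ℂ, 0 < z.im → P (-1 / z) = z ^ (12 * n) * P z)
    (hl : Tendsto (fun z : ℂ => P z / Complex.exp (2 * π * Complex.I * z) ^ n)
      (comap Complex.im atTop) (𝓝 c)) :
    ∀ z : ℍ, P z = c * discriminant z ^ n := by
  have hl' : Tendsto (fun z : ℍ => P z / discriminant z ^ n) atImInfty (𝓝 c) := by
    have h1 : Tendsto (fun z : ℍ => (z : ℂ)) atImInfty (comap Complex.im atTop) := by
      rw [tendsto_comap_iff]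
      exact tendsto_comap
    have h2 := (hl.comp h1).div (tendsto_atImInfty_tprod_one_sub_eta_q_pow.pow n) (by simp)
    simp only [one_pow, div_one] at h2
    refine h2.congr fun z => ?_
    simp only [Pi.div_apply, Function.comp]
    rw [discriminant_eq_q_prod, mul_pow, div_div]
    simp [Function.Periodic.qParam]
  set f : ℍ → ℂ := fun z => P z / discriminant z ^ n with hf
  have hfT : f ∣[(0 : ℤ)] ModularGroup.T = f := by
    ext z
    rw [SL_slash_apply]
    simp only [neg_zero, zpow_zero, mul_one, hf, aux_DT]
    rw [modular_T_smul]
    congr 1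
    have := hT z z.2
    rw [← this]
    congr 1
    simp [add_comm]
  have hfS : f ∣[(0 : ℤ)] ModularGroup.S = f := by
    ext z
    rw [SL_slash_apply]
    simp only [neg_zero, zpow_zero, mul_one, hf, aux_DS]
    rw [modular_S_smul]
    have := hS z z.2
    have hz := z.ne_zero
    have hD := discriminant_ne_zero z
    rw [show ((UpperHalfPlane.mk (-(z : ℂ))⁻¹ z.im_inv_neg_coe_pos : ℍ) : ℂ) = -1 / z by
      simp [neg_div], this]
    rw [mul_pow, ← pow_mul]
    field_simp
  have hinv := SlashInvariantForm.slash_action_generators_SL2Z hfS hfT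
  let F : ModularForm 𝒮ℒ 0 :=
    { toFun := f
      slash_action_eq' := fun A hA => by
        obtain ⟨A, rfl⟩ := hA
        exact hinv A
      holo' := by
        have h1 : MDifferentiable 𝓘(ℂ) 𝓘(ℂ) (fun z : ℍ => P z) := by
          rw [UpperHalfPlane.mdifferentiable_iff]
          refine hd.congr fun z hz => ?_
          simp [ofComplex_apply_of_im_pos hz]
        have h2 := CuspForm.discriminant.holo'
        exact h1.div (h2.pow n) (fun z => pow_ne_zero _ (discriminant_ne_zero z))
      bdd_at_cusps' := by
        intro c hc
        rw [Subgroup.IsArithmetic.isCusp_iff_isCusp_SL2Z] at hc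
        rw [OnePoint.isBoundedAt_iff_forall_SL2Z hc]
        intro γ _
        rw [hinv γ, IsBoundedAtImInfty, BoundedAtFilter]
        exact hl'.isBigO_one ℝ }
  obtain ⟨d, hd⟩ := ModularFormClass.levelOne_weight_zero_const F
  have hfd : ∀ z, f z = d := fun z => congrFun hd z
  have hcd : d = c := by
    refine tendsto_nhds_unique ?_ hl'
    refine tendsto_const_nhds.congr fun z => (hfd z).symm
  intro z
  have := hfd z
  have hD := discriminant_ne_zero z
  simp only [hf] at this
  rw [div_eq_iff (pow_ne_zero _ hD), hcd] at this
  exact this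

abbrev HH : Set ℂ := {z : ℂ | 0 < z.im}

lemma isOpen_HH : IsOpen HH := isOpen_lt continuous_const Complex.continuous_im

lemma neg_inv_mem {z : ℂ} (hz : 0 < z.im) : 0 < (-1 / z).im := by
  have := (UpperHalfPlane.mk z hz).im_inv_neg_coe_pos
  simpa [neg_div, inv_neg] using this

/-- the second factor of `θ₂` -/
def uu (τ : ℂ) : ℂ := jacobiTheta₂ (τ / 2) τ

lemma theta_eq (τ : ℂ) : theta τ = jacobiTheta₂ 0 τ := by
  simp [theta, jacobiTheta₂, jacobiTheta₂_term]

lemma theta_eq' (τ : ℂ) : theta τ = jacobiTheta τ := by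
  rw [theta_eq, jacobiTheta_eq_jacobiTheta₂]

lemma theta4_eq (τ : ℂ) : theta4 τ = jacobiTheta₂ (1 / 2) τ := by
  unfold theta4 jacobiTheta₂ jacobiTheta₂_term
  refine tsum_congr fun n => ?_
  rw [Complex.exp_add]
  congr 1
  rw [show 2 * (π : ℂ) * Complex.I * n * (1 / 2) = n * (π * Complex.I) by ring, Complex.exp_int_mul,
    Complex.exp_pi_mul_I]

lemma theta2_eq (τ : ℂ) : theta2 τ = Complex.exp (π * Complex.I / 4 * τ) * uu τ := by
  unfold theta2 uu jacobiTheta₂ jacobiTheta₂_term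
  rw [← tsum_mul_left]
  refine tsum_congr fun n => ?_
  rw [← Complex.exp_add]
  congr 1
  ring

lemma theta_T (τ : ℂ) : theta (τ + 1) = theta4 τ := by
  unfold theta theta4
  refine tsum_congr fun n => ?_
  rw [mul_add, Complex.exp_add, mul_comm]
  congr 1
  rw [show (π : ℂ) * Complex.I * n ^ 2 * 1 = (n ^ 2 : ℤ) * (π * Complex.I) by push_cast; ring,
    Complex.exp_int_mul, Complex.exp_pi_mul_I]
  rcases Int.even_or_odd n with h | h
  · rw [h.neg_one_zpow, (h.pow_of_ne_zero two_ne_zero).neg_one_zpow]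
  · rw [h.neg_one_zpow, h.pow.neg_one_zpow]

lemma theta4_T (τ : ℂ) : theta4 (τ + 1) = theta τ := by
  rw [← theta_T, theta_eq, theta_eq, add_assoc, one_add_one_eq_two, jacobiTheta₂_add_right]

lemma theta2_T (τ : ℂ) : theta2 (τ + 1) = Complex.exp (π * Complex.I / 4) * theta2 τ := by
  unfold theta2
  rw [← tsum_mul_left]
  refine tsum_congr fun n => ?_
  obtain ⟨k, hk⟩ := Int.even_mul_succ_self n
  have hk' : (n : ℂ) * (n + 1) = k + k := by exact_mod_cast hk
  rw [show (π : ℂ) * Complex.I * (n + 1 / 2) ^ 2 * (τ + 1) =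
    k * (2 * π * Complex.I) + (π * Complex.I / 4 + π * Complex.I * (n + 1 / 2) ^ 2 * τ) by
      linear_combination (π * Complex.I) * hk', Complex.exp_add, Complex.exp_int_mul_two_pi_mul_I,
      one_mul, Complex.exp_add]

/-- the automorphy factor -/
def gg (τ : ℂ) : ℂ := (-Complex.I * τ) ^ (1 / 2 : ℂ)

lemma re_pos_of_mem {τ : ℂ} (hτ : 0 < τ.im) : 0 < (-Complex.I * τ).re := by simpa using hτ

lemma ne_zero_of_mem {τ : ℂ} (hτ : 0 < τ.im) : τ ≠ 0 := by
  rintro rfl; simp at hτ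

lemma gg_ne {τ : ℂ} (hτ : 0 < τ.im) : gg τ ≠ 0 := by
  unfold gg
  rw [Complex.cpow_ne_zero_iff]
  left
  simpa using ne_zero_of_mem hτ

lemma gg_sq (τ : ℂ) : gg τ ^ 2 = -Complex.I * τ := by
  unfold gg
  rw [← Complex.cpow_nat_mul]
  simp

lemma gg_deriv {τ : ℂ} (hτ : 0 < τ.im) : HasDerivAt gg (gg τ / (2 * τ)) τ := by
  have hne := ne_zero_of_mem hτ
  have h1 : HasDerivAt (fun z : ℂ => -Complex.I * z) (-Complex.I) τ := by
    simpa using (hasDerivAt_id τ).const_mul (-Complex.I)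
  have h2 := h1.cpow_const (c := (1 / 2 : ℂ)) (Or.inl (re_pos_of_mem hτ))
  refine h2.congr_deriv ?_
  have h3 : -Complex.I * τ ≠ 0 := by simpa using hne
  rw [Complex.cpow_sub _ _ h3, Complex.cpow_one]
  unfold gg
  field_simp

lemma theta_S {τ : ℂ} (hτ : 0 < τ.im) : theta (-1 / τ) = gg τ * theta τ := by
  have h := jacobiTheta₂_functional_equation 0 τ
  have hg := gg_ne hτ
  rw [theta_eq, theta_eq, h]
  change _ = gg τ * (1 / gg τ * _ * _)
  simp
  field_simp

lemma theta2_S {τ : ℂ} (hτ : 0 < τ.im) : theta2 (-1 / τ) = gg τ * theta4 τ := by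
  have h := jacobiTheta₂_functional_equation (1 / 2) τ
  have hg := gg_ne hτ
  have hne := ne_zero_of_mem hτ
  rw [theta2_eq, theta4_eq, h, uu, ← jacobiTheta₂_neg_left]
  unfold gg at *
  rw [show -(-1 / τ / 2) = 1 / 2 / τ by field_simp,
    show π * Complex.I / 4 * (-1 / τ) = -π * Complex.I * (1 / 2) ^ 2 / τ by field_simp; norm_num]
  field_simp

lemma theta4_S {τ : ℂ} (hτ : 0 < τ.im) : theta4 (-1 / τ) = gg τ * theta2 τ := by
  have h := jacobiTheta₂_functional_equation (τ / 2) τ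
  have hg := gg_ne hτ
  have hne := ne_zero_of_mem hτ
  rw [theta2_eq, theta4_eq, uu, h]
  unfold gg at *
  rw [show τ / 2 / τ = 1 / 2 by field_simp]
  have h2 : Complex.exp (π * Complex.I / 4 * τ) * Complex.exp (-π * Complex.I * (τ / 2) ^ 2 / τ) = 1 := by
    rw [← Complex.exp_add, Complex.exp_eq_one_iff]
    refine ⟨0, ?_⟩
    field_simp
    norm_num
  change _ = gg τ * (_ * (1 / gg τ * _ * _))
  have h3 : gg τ * (1 / gg τ) = 1 := by
    have : gg τ ≠ 0 := hg
    field_simp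
  linear_combination (-jacobiTheta₂ (1/2) (-1/τ)) * h2 - jacobiTheta₂ (1/2) (-1/τ) *
    (Complex.exp (π * Complex.I / 4 * τ) * Complex.exp (-π * Complex.I * (τ / 2) ^ 2 / τ)) * h3

lemma theta_diff : DifferentiableOn ℂ theta HH := by
  intro z hz
  rw [show theta = jacobiTheta₂ 0 from funext theta_eq]
  exact (differentiableAt_jacobiTheta₂_snd 0 hz).differentiableWithinAt

lemma theta4_diff : DifferentiableOn ℂ theta4 HH := by
  intro z hz
  rw [show theta4 = jacobiTheta₂ (1 / 2) from funext theta4_eq]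
  exact (differentiableAt_jacobiTheta₂_snd _ hz).differentiableWithinAt

lemma uu_diff : DifferentiableOn ℂ uu HH := by
  intro z hz
  have h1 := (hasFDerivAt_jacobiTheta₂ (z / 2) hz).differentiableAt
  have h2 : DifferentiableAt ℂ (fun w : ℂ => (w / 2, w)) z := by fun_prop
  exact (DifferentiableAt.comp (g := fun p : ℂ × ℂ => jacobiTheta₂ p.1 p.2)
    (f := fun w : ℂ => (w / 2, w)) z h1 h2).differentiableWithinAt

lemma theta2_diff : DifferentiableOn ℂ theta2 HH := by
  rw [show theta2 = fun τ => Complex.exp (π * Complex.I / 4 * τ) * uu τ from funext theta2_eq]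
  have := uu_diff
  fun_prop

/-- The Rankin–Cohen type bracket. -/
def EE (f : ℂ → ℂ) (τ : ℂ) : ℂ := f τ * deriv (deriv f) τ - 3 * deriv f τ ^ 2

lemma EE_T {f h : ℂ → ℂ} {c : ℂ} (H : ∀ τ, f (τ + 1) = c * h τ) (τ : ℂ) :
    EE f (τ + 1) = c ^ 2 * EE h τ := by
  have h1 : ∀ τ, deriv f (τ + 1) = c * deriv h τ := by
    intro τ
    rw [← deriv_comp_add_const f 1 τ, ← deriv_const_mul_field c, funext H]
  have h2 : ∀ τ, deriv (deriv f) (τ + 1) = c * deriv (deriv h) τ := by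
    intro τ
    rw [← deriv_comp_add_const (deriv f) 1 τ, ← deriv_const_mul_field c, funext h1]
  simp only [EE, h1, h2, H]
  ring

lemma EE_diff {f : ℂ → ℂ} (hf : DifferentiableOn ℂ f HH) : DifferentiableOn ℂ (EE f) HH := by
  have h1 := hf.deriv isOpen_HH
  have h2 := h1.deriv isOpen_HH
  unfold EE
  fun_prop

lemma hasDerivAt_comp_neg_inv {f : ℂ → ℂ} (hf : DifferentiableOn ℂ f HH) {τ : ℂ} (hτ : 0 < τ.im) :
    HasDerivAt (fun z => f (-1 / z)) (deriv f (-1 / τ) * (1 / τ ^ 2)) τ := by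
  have hne := ne_zero_of_mem hτ
  have h1 : HasDerivAt (fun z : ℂ => -1 / z) (1 / τ ^ 2) τ := by
    have := (hasDerivAt_inv hne).neg
    refine (this.congr_of_eventuallyEq (Eventually.of_forall fun z => ?_)).congr_deriv ?_
    · simp [neg_div]
    · simp
  have h2 := (hf.differentiableAt (isOpen_HH.mem_nhds (neg_inv_mem hτ))).hasDerivAt
  exact h2.comp τ h1

lemma EE_S {f h : ℂ → ℂ} (hf : DifferentiableOn ℂ f HH) (hh : DifferentiableOn ℂ h HH)
    (H : ∀ τ, 0 < τ.im → f (-1 / τ) = gg τ * h τ) {τ : ℂ} (hτ : 0 < τ.im) :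
    EE f (-1 / τ) = gg τ ^ 2 * τ ^ 4 * EE h τ := by
  have hf1 := hf.deriv isOpen_HH
  have hh1 := hh.deriv isOpen_HH
  have D0 : ∀ z, 0 < z.im → HasDerivAt h (deriv h z) z := fun z hz =>
    (hh.differentiableAt (isOpen_HH.mem_nhds hz)).hasDerivAt
  have D1 : ∀ z, 0 < z.im → HasDerivAt (deriv h) (deriv (deriv h) z) z := fun z hz =>
    (hh1.differentiableAt (isOpen_HH.mem_nhds hz)).hasDerivAt
  have h1 : ∀ τ, 0 < τ.im → deriv f (-1 / τ) = gg τ * (τ ^ 2 * deriv h τ + τ / 2 * h τ) := by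
    intro τ hτ
    have hne := ne_zero_of_mem hτ
    have a := hasDerivAt_comp_neg_inv hf hτ
    have b := (gg_deriv hτ).mul (D0 τ hτ)
    have e : (fun z => f (-1 / z)) =ᶠ[𝓝 τ] (gg * h) := by
      filter_upwards [isOpen_HH.mem_nhds hτ] with z hz using H z hz
    have := a.unique (b.congr_of_eventuallyEq e)
    field_simp at this ⊢
    linear_combination this
  have h2 : deriv (deriv f) (-1 / τ) =
      gg τ * (τ ^ 4 * deriv (deriv h) τ + 3 * τ ^ 3 * deriv h τ + 3 / 4 * τ ^ 2 * h τ) := by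
    have hne := ne_zero_of_mem hτ
    have a := hasDerivAt_comp_neg_inv hf1 hτ
    have b := (gg_deriv hτ).mul ((((hasDerivAt_id τ).pow 2).mul (D1 τ hτ)).add
      (((hasDerivAt_id τ).div_const 2).mul (D0 τ hτ)))
    have e : (fun z => deriv f (-1 / z)) =ᶠ[𝓝 τ]
        (gg * (id ^ 2 * deriv h + (fun z => id z / 2) * h)) := by
      filter_upwards [isOpen_HH.mem_nhds hτ] with z hz using h1 z hz
    have := a.unique (b.congr_of_eventuallyEq e)
    simp only [Pi.add_apply, Pi.mul_apply, Pi.pow_apply, id] at this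
    field_simp at this ⊢
    push_cast at this
    linear_combination this
  simp only [EE, h1 τ hτ, h2, H τ hτ]
  ring

/-- The filter `im τ → ∞`. -/
abbrev LL : Filter ℂ := comap Complex.im atTop

lemma eventually_LL {p : ℂ → Prop} : (∀ᶠ z in LL, p z) ↔ ∃ M : ℝ, ∀ z : ℂ, M ≤ z.im → p z := by
  rw [eventually_comap, eventually_atTop]
  constructor
  · rintro ⟨M, h⟩
    exact ⟨M, fun z hz => h _ hz z rfl⟩
  · rintro ⟨M, h⟩
    exact ⟨M, fun b hb z hz => h z (hz ▸ hb)⟩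

lemma eventually_HH : ∀ᶠ z in LL, 0 < z.im :=
  eventually_LL.2 ⟨1, fun z hz => by linarith⟩

lemma deriv_isBigO {f : ℂ → ℂ} (hf : DifferentiableOn ℂ f HH)
    (h : f =O[LL] fun z => Real.exp (-π * z.im)) :
    deriv f =O[LL] fun z => Real.exp (-π * z.im) := by
  obtain ⟨C, hC⟩ := h.bound
  obtain ⟨M, hM⟩ := eventually_LL.1 hC
  refine IsBigO.of_bound (C * Real.exp π) (eventually_LL.2 ⟨max M 0 + 2, fun z hz => ?_⟩)
  have hM1 : M + 2 ≤ z.im := by linarith [le_max_left M 0]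
  have hM2 : 2 ≤ z.im := by linarith [le_max_right M 0]
  have him : ∀ w ∈ Metric.closedBall z 1, z.im - 1 ≤ w.im := by
    intro w hw
    rw [mem_closedBall_iff_norm] at hw
    have := (Complex.abs_im_le_norm (w - z)).trans hw
    rw [Complex.sub_im, abs_le] at this
    linarith [this.1]
  have hC0 : 0 ≤ C := by
    have := (norm_nonneg _).trans (hM z (by linarith))
    by_contra hneg
    have h3 : C * ‖Real.exp (-π * z.im)‖ < 0 :=
      mul_neg_of_neg_of_pos (not_le.1 hneg) (norm_pos_iff.2 (Real.exp_ne_zero _))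
    linarith
  have key : ∀ w ∈ Metric.sphere z 1, ‖f w‖ ≤ C * Real.exp π * ‖Real.exp (-π * z.im)‖ := by
    intro w hw
    have h1 := him w (Metric.sphere_subset_closedBall hw)
    refine (hM w (by linarith)).trans ?_
    rw [mul_assoc, Real.norm_of_nonneg (Real.exp_pos _).le, Real.norm_of_nonneg (Real.exp_pos _).le,
      ← Real.exp_add]
    gcongr
    nlinarith [Real.pi_pos]
  have hd : DiffContOnCl ℂ f (Metric.ball z 1) := by
    apply DifferentiableOn.diffContOnCl
    rw [closure_ball z one_ne_zero]
    refine hf.mono fun w hw => ?_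
    have := him w hw
    show 0 < w.im
    linarith
  simpa using Complex.norm_deriv_le_of_forall_mem_sphere_norm_le one_pos hd key

lemma theta_isBigO : (fun z => theta z - 1) =O[LL] fun z => Real.exp (-π * z.im) := by
  simp only [theta_eq']
  exact isBigO_at_im_infty_jacobiTheta_sub_one

lemma theta4_isBigO : (fun z => theta4 z - 1) =O[LL] fun z => Real.exp (-π * z.im) := by
  have h : Tendsto (fun z : ℂ => z + 1) LL LL := by
    rw [tendsto_comap_iff]
    have : Complex.im ∘ (fun z : ℂ => z + 1) = Complex.im := by ext z; simp
    rw [this]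
    exact tendsto_comap
  have := theta_isBigO.comp_tendsto h
  simpa [Function.comp_def, theta_T] using this

lemma uu_bound {τ : ℂ} (hτ : 1 ≤ τ.im) :
    ‖uu τ - 2‖ ≤ 2 * (1 - Real.exp (-π))⁻¹ * Real.exp (-π * τ.im) := by
  have hτ0 : 0 < τ.im := by linarith
  have hs := (summable_jacobiTheta₂_term_iff (τ / 2) τ).2 hτ0
  have e1 : ∀ n : ℕ, jacobiTheta₂_term (n : ℤ) (τ / 2) τ =
      Complex.exp (π * Complex.I * (n * (n + 1)) * τ) := by
    intro n
    unfold jacobiTheta₂_term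
    push_cast
    congr 1
    ring
  have e2 : ∀ n : ℕ, jacobiTheta₂_term (-((n : ℤ) + 1)) (τ / 2) τ =
      Complex.exp (π * Complex.I * (n * (n + 1)) * τ) := by
    intro n
    unfold jacobiTheta₂_term
    push_cast
    congr 1
    ring
  have hs1 : Summable fun n : ℕ => Complex.exp (π * Complex.I * (n * (n + 1)) * τ) := by
    have := hs.comp_injective Nat.cast_injective
    exact this.congr e1
  have hu : uu τ = 2 + 2 * ∑' n : ℕ,
      Complex.exp (π * Complex.I * (((n + 1 : ℕ) : ℂ) * (((n + 1 : ℕ) : ℂ) + 1)) * τ) := by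
    have h1 := HasSum.of_nat_of_neg_add_one (f := fun n : ℤ => jacobiTheta₂_term n (τ / 2) τ)
      (hs1.hasSum.congr_fun (fun n => (e1 n)) ) (hs1.hasSum.congr_fun (fun n => (e2 n)))
    have h2 := h1.tsum_eq
    rw [hs1.tsum_eq_zero_add] at h2
    unfold uu jacobiTheta₂
    rw [h2]
    simp
    ring
  rw [hu, add_sub_cancel_left, norm_mul, Complex.norm_ofNat, mul_assoc]
  gcongr
  set r := Real.exp (-π * τ.im) with hr
  have hr0 : 0 < r := Real.exp_pos _
  have hrle : r ≤ Real.exp (-π) := by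
    rw [hr]; gcongr; nlinarith [Real.pi_pos]
  have he1 : Real.exp (-π) < 1 := by
    rw [Real.exp_lt_one_iff]; linarith [Real.pi_pos]
  have hg : HasSum (fun n : ℕ => Real.exp (-π) ^ n * r) ((1 - Real.exp (-π))⁻¹ * r) :=
    (hasSum_geometric_of_lt_one (Real.exp_pos _).le he1).mul_right r
  refine tsum_of_norm_bounded hg fun n => ?_
  have : ‖Complex.exp (π * Complex.I * (((n + 1 : ℕ) : ℂ) * (((n + 1 : ℕ) : ℂ) + 1)) * τ)‖
      = Real.exp (-π * ((n + 1) * (n + 2)) * τ.im) := by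
    rw [Complex.norm_exp]
    congr 1
    rw [show (π * Complex.I * (((n + 1 : ℕ) : ℂ) * (((n + 1 : ℕ) : ℂ) + 1)) * τ) =
      ((π * ((n + 1) * (n + 2)) : ℝ) : ℂ) * (Complex.I * τ) by push_cast; ring,
      Complex.re_ofReal_mul]
    simp
  rw [this, hr, ← Real.exp_nat_mul, ← Real.exp_add]
  gcongr
  have h3 : (0 : ℝ) ≤ n := Nat.cast_nonneg n
  have h5 : (n : ℝ) + τ.im ≤ (n + 1) * (n + 2) * τ.im := by nlinarith [mul_nonneg h3 hτ0.le, mul_nonneg (mul_nonneg h3 h3) hτ0.le]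
  nlinarith [mul_le_mul_of_nonneg_left h5 Real.pi_pos.le]

lemma uu_isBigO : (fun z => uu z - 2) =O[LL] fun z => Real.exp (-π * z.im) := by
  refine IsBigO.of_bound (2 * (1 - Real.exp (-π))⁻¹) (eventually_LL.2 ⟨1, fun z hz => ?_⟩)
  rw [Real.norm_of_nonneg (Real.exp_pos _).le]
  exact uu_bound hz

lemma exp_tendsto : Tendsto (fun z : ℂ => Real.exp (-π * z.im)) LL (𝓝 0) := by
  refine Real.tendsto_exp_atBot.comp ?_
  exact (tendsto_const_nhds.neg_mul_atTop (neg_neg_of_pos Real.pi_pos) tendsto_comap)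

lemma deriv1 {f : ℂ → ℂ} {c : ℂ} (hf : DifferentiableOn ℂ f HH)
    (h : (fun z => f z - c) =O[LL] fun z => Real.exp (-π * z.im)) :
    deriv f =O[LL] fun z => Real.exp (-π * z.im) := by
  have := deriv_isBigO (hf.sub_const c) h
  refine this.congr_left fun z => ?_
  exact deriv_sub_const c

lemma lim0 {f : ℂ → ℂ} {c : ℂ}
    (h : (fun z => f z - c) =O[LL] fun z => Real.exp (-π * z.im)) : Tendsto f LL (𝓝 c) := by
  have := h.trans_tendsto exp_tendsto
  simpa using this.add_const c

/-- `G₃` -/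
def G3 (τ : ℂ) : ℂ := EE theta τ + π ^ 2 / 8 * (theta τ ^ 2 * theta2 τ ^ 4 * theta4 τ ^ 4)
/-- `G₄` -/
def G4 (τ : ℂ) : ℂ := EE theta4 τ - π ^ 2 / 8 * (theta4 τ ^ 2 * theta2 τ ^ 4 * theta τ ^ 4)
/-- `G₂` -/
def G2 (τ : ℂ) : ℂ := EE theta2 τ - π ^ 2 / 8 * (theta2 τ ^ 2 * theta τ ^ 4 * theta4 τ ^ 4)

lemma exp_quarter_pow4 : Complex.exp (π * Complex.I / 4) ^ 4 = -1 := by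
  rw [← Complex.exp_nat_mul, ← Complex.exp_pi_mul_I]
  congr 1
  push_cast
  ring

lemma G3_T (τ : ℂ) : G3 (τ + 1) = G4 τ := by
  have := EE_T (f := theta) (h := theta4) (c := 1) (fun τ => by rw [theta_T, one_mul]) τ
  simp only [G3, G4, this, theta_T, theta2_T, theta4_T, mul_pow, exp_quarter_pow4]
  ring

lemma G4_T (τ : ℂ) : G4 (τ + 1) = G3 τ := by
  have := EE_T (f := theta4) (h := theta) (c := 1) (fun τ => by rw [theta4_T, one_mul]) τ
  simp only [G3, G4, this, theta_T, theta2_T, theta4_T, mul_pow, exp_quarter_pow4]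
  ring

lemma G2_T (τ : ℂ) : G2 (τ + 1) = Complex.exp (π * Complex.I / 4) ^ 2 * G2 τ := by
  have := EE_T (f := theta2) (h := theta2) theta2_T τ
  simp only [G2, this, theta_T, theta2_T, theta4_T, mul_pow]
  ring

lemma gg_pow8 (τ : ℂ) : gg τ ^ 8 = τ ^ 4 := by
  rw [show gg τ ^ 8 = (gg τ ^ 2) ^ 4 by ring, gg_sq, mul_pow]
  simp [Even.neg_pow (show Even 4 by decide)]

lemma G3_S {τ : ℂ} (hτ : 0 < τ.im) : G3 (-1 / τ) = gg τ ^ 2 * τ ^ 4 * G3 τ := by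
  have := EE_S theta_diff theta_diff (fun τ h => theta_S h) hτ
  have h8 := gg_pow8 τ
  simp only [G3, this, theta_S hτ, theta2_S hτ, theta4_S hτ]
  linear_combination (π ^ 2 / 8 * (theta τ ^ 2 * theta2 τ ^ 4 * theta4 τ ^ 4) * gg τ ^ 2) * h8

lemma G4_S {τ : ℂ} (hτ : 0 < τ.im) : G4 (-1 / τ) = gg τ ^ 2 * τ ^ 4 * G2 τ := by
  have := EE_S theta4_diff theta2_diff (fun τ h => theta4_S h) hτ
  have h8 := gg_pow8 τ
  simp only [G4, G2, this, theta_S hτ, theta2_S hτ, theta4_S hτ]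
  linear_combination (-π ^ 2 / 8 * (theta2 τ ^ 2 * theta τ ^ 4 * theta4 τ ^ 4) * gg τ ^ 2) * h8

lemma G2_S {τ : ℂ} (hτ : 0 < τ.im) : G2 (-1 / τ) = gg τ ^ 2 * τ ^ 4 * G4 τ := by
  have := EE_S theta2_diff theta4_diff (fun τ h => theta2_S h) hτ
  have h8 := gg_pow8 τ
  simp only [G4, G2, this, theta_S hτ, theta2_S hτ, theta4_S hτ]
  linear_combination (-π ^ 2 / 8 * (theta4 τ ^ 2 * theta τ ^ 4 * theta2 τ ^ 4) * gg τ ^ 2) * h8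

lemma G3_diff : DifferentiableOn ℂ G3 HH := by
  have h1 := EE_diff theta_diff
  have h2 := theta_diff
  have h3 := theta2_diff
  have h4 := theta4_diff
  unfold G3
  fun_prop

lemma G4_diff : DifferentiableOn ℂ G4 HH := by
  have h1 := EE_diff theta4_diff
  have h2 := theta_diff
  have h3 := theta2_diff
  have h4 := theta4_diff
  unfold G4
  fun_prop

lemma G2_diff : DifferentiableOn ℂ G2 HH := by
  have h1 := EE_diff theta2_diff
  have h2 := theta_diff
  have h3 := theta2_diff
  have h4 := theta4_diff
  unfold G2
  fun_prop

lemma theta_ne {τ : ℂ} (hτ : 0 < τ.im) : theta τ ≠ 0 := by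
  have h := aux_levelOne 1 (fun z => (theta2 z * theta z * theta4 z) ^ 8) 256
    (by
      have h2 := theta_diff
      have h3 := theta2_diff
      have h4 := theta4_diff
      fun_prop)
    (by
      intro z hz
      have h4 := exp_quarter_pow4
      simp only [theta_T, theta2_T, theta4_T]
      generalize Complex.exp (π * Complex.I / 4) = w at *
      have h8 : w ^ 8 = 1 := by rw [show w ^ 8 = (w ^ 4) ^ 2 by ring, h4]; norm_num
      linear_combination ((theta2 z * theta z * theta4 z) ^ 8) * h8)
    (by
      intro z hz
      have h8 := gg_pow8 z
      simp only [theta_S hz, theta2_S hz, theta4_S hz]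
      rw [show (gg z * theta4 z * (gg z * theta z) * (gg z * theta2 z)) ^ 8 =
        (gg z ^ 8) ^ 3 * (theta2 z * theta z * theta4 z) ^ 8 by ring, h8]
      ring)
    (by
      have h : Tendsto (fun z => (uu z * theta z * theta4 z) ^ 8) LL (𝓝 ((2 * 1 * 1) ^ 8)) :=
        (((lim0 uu_isBigO).mul (lim0 theta_isBigO)).mul (lim0 theta4_isBigO)).pow 8
      norm_num at h
      refine h.congr fun z => ?_
      rw [theta2_eq, pow_one, eq_div_iff (Complex.exp_ne_zero _)]
      have : Complex.exp (2 * π * Complex.I * z) = Complex.exp (π * Complex.I / 4 * z) ^ 8 := by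
        rw [← Complex.exp_nat_mul]
        congr 1
        push_cast
        ring
      rw [this]
      ring)
    ⟨τ, hτ⟩
  intro h0
  have hd := discriminant_ne_zero ⟨τ, hτ⟩
  simp [h0] at h
  exact hd h

/-- the second factor of `G₂` -/
def K2 (τ : ℂ) : ℂ :=
  uu τ * (deriv (deriv uu) τ + 2 * (π * Complex.I / 4) * deriv uu τ + (π * Complex.I / 4) ^ 2 * uu τ)
    - 3 * (deriv uu τ + (π * Complex.I / 4) * uu τ) ^ 2
    - π ^ 2 / 8 * (uu τ ^ 2 * theta τ ^ 4 * theta4 τ ^ 4)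

lemma hasDerivAt_exp_mul {f : ℂ → ℂ} (hf : DifferentiableOn ℂ f HH) {τ : ℂ} (hτ : 0 < τ.im) (c : ℂ) :
    HasDerivAt (fun z => Complex.exp (c * z) * f z)
      (Complex.exp (c * τ) * (deriv f τ + c * f τ)) τ := by
  have h1 := (hf.differentiableAt (isOpen_HH.mem_nhds hτ)).hasDerivAt
  have h2 : HasDerivAt (fun z => Complex.exp (c * z)) (Complex.exp (c * τ) * (c * 1)) τ :=
    ((hasDerivAt_id τ).const_mul c).cexp
  exact (h2.mul h1).congr_deriv (by ring)

lemma G2_eq {τ : ℂ} (hτ : 0 < τ.im) : G2 τ = Complex.exp (π * Complex.I / 4 * τ) ^ 2 * K2 τ := by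
  have e0 : theta2 = fun z => Complex.exp (π * Complex.I / 4 * z) * uu z := funext theta2_eq
  have e1 : ∀ z : ℂ, 0 < z.im → deriv theta2 z =
      Complex.exp (π * Complex.I / 4 * z) * (deriv uu z + π * Complex.I / 4 * uu z) := by
    intro z hz
    rw [e0]
    exact (hasDerivAt_exp_mul uu_diff hz _).deriv
  have d1 := uu_diff.deriv isOpen_HH
  have d2 : DifferentiableOn ℂ (fun z => deriv uu z + π * Complex.I / 4 * uu z) HH := by
    have := uu_diff
    fun_prop
  have e2 : deriv (deriv theta2) τ = Complex.exp (π * Complex.I / 4 * τ) *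
      (deriv (deriv uu) τ + 2 * (π * Complex.I / 4) * deriv uu τ
        + (π * Complex.I / 4) ^ 2 * uu τ) := by
    have h1 : deriv theta2 =ᶠ[𝓝 τ] fun z =>
        Complex.exp (π * Complex.I / 4 * z) * (deriv uu z + π * Complex.I / 4 * uu z) := by
      filter_upwards [isOpen_HH.mem_nhds hτ] with z hz using e1 z hz
    rw [h1.deriv_eq, (hasDerivAt_exp_mul d2 hτ _).deriv]
    have h3 : HasDerivAt (fun z => deriv uu z + π * Complex.I / 4 * uu z)
        (deriv (deriv uu) τ + π * Complex.I / 4 * deriv uu τ) τ :=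
      (d1.differentiableAt (isOpen_HH.mem_nhds hτ)).hasDerivAt.add
        ((uu_diff.differentiableAt (isOpen_HH.mem_nhds hτ)).hasDerivAt.const_mul _)
    rw [h3.deriv]
    ring
  rw [G2, EE, e2, e1 τ hτ, theta2_eq, K2]
  ring

lemma tendsto_of_isBigO {f : ℂ → ℂ} (h : f =O[LL] fun z => Real.exp (-π * z.im)) :
    Tendsto f LL (𝓝 0) := h.trans_tendsto exp_tendsto

lemma K2_tendsto : Tendsto K2 LL (𝓝 0) := by
  have t0 := lim0 uu_isBigO
  have b1 := deriv1 uu_diff uu_isBigO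
  have t1 := tendsto_of_isBigO b1
  have t2 := tendsto_of_isBigO (deriv_isBigO (uu_diff.deriv isOpen_HH) b1)
  have t3 := lim0 theta_isBigO
  have t4 := lim0 theta4_isBigO
  have := ((t0.mul ((t2.add (t1.const_mul (2 * (π * Complex.I / 4)))).add
      (t0.const_mul ((π * Complex.I / 4) ^ 2)))).sub
    (((t1.add (t0.const_mul (π * Complex.I / 4))).pow 2).const_mul 3)).sub
    ((((t0.pow 2).mul (t3.pow 4)).mul (t4.pow 4)).const_mul ((π : ℂ) ^ 2 / 8))
  refine (show Tendsto K2 LL _ from this).trans (le_of_eq (congrArg 𝓝 ?_))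
  linear_combination (-π ^ 2 / 2) * Complex.I_sq

lemma norm_exp_pi (z : ℂ) : ‖Complex.exp (π * Complex.I * z)‖ = Real.exp (-π * z.im) := by
  rw [Complex.norm_exp, mul_assoc, Complex.re_ofReal_mul]
  simp

lemma EE_isBigO {f : ℂ → ℂ} {c : ℂ} (hf : DifferentiableOn ℂ f HH)
    (h : (fun z => f z - c) =O[LL] fun z => Real.exp (-π * z.im)) :
    EE f =O[LL] fun z => Real.exp (-π * z.im) := by
  have b1 := deriv1 hf h
  have b2 := deriv_isBigO (hf.deriv isOpen_HH) b1
  have o0 := (lim0 h).isBigO_one ℝ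
  have o1 := (tendsto_of_isBigO b1).isBigO_one ℝ
  have s1 : (fun z => f z * deriv (deriv f) z) =O[LL] fun z => Real.exp (-π * z.im) := by
    simpa using o0.mul b2
  have s2 : (fun z => 3 * deriv f z ^ 2) =O[LL] fun z => Real.exp (-π * z.im) := by
    have := (o1.mul b1).const_mul_left 3
    simpa [pow_two] using this
  exact s1.sub s2

lemma theta2_pow4_isBigO : (fun z => theta2 z ^ 4) =O[LL] fun z => Real.exp (-π * z.im) := by
  have h1 : (fun z : ℂ => Complex.exp (π * Complex.I * z)) =O[LL] fun z => Real.exp (-π * z.im) := by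
    refine IsBigO.of_bound 1 (Eventually.of_forall fun z => ?_)
    rw [norm_exp_pi, one_mul]
    exact le_abs_self _
  have h2 := h1.mul (((lim0 uu_isBigO).pow 4).isBigO_one ℝ)
  simp only [mul_one] at h2
  refine h2.congr_left fun z => ?_
  rw [theta2_eq, mul_pow, ← Complex.exp_nat_mul]
  congr 2
  push_cast
  ring

lemma G3_isBigO : G3 =O[LL] fun z => Real.exp (-π * z.im) := by
  have o3 := ((lim0 theta_isBigO).pow 2).isBigO_one ℝ
  have o4 := ((lim0 theta4_isBigO).pow 4).isBigO_one ℝ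
  have := ((o3.mul theta2_pow4_isBigO).mul o4).const_mul_left ((π : ℂ) ^ 2 / 8)
  simp only [one_mul, mul_one] at this
  exact (EE_isBigO theta_diff theta_isBigO).add this

lemma G4_isBigO : G4 =O[LL] fun z => Real.exp (-π * z.im) := by
  have o3 := ((lim0 theta4_isBigO).pow 2).isBigO_one ℝ
  have o4 := ((lim0 theta_isBigO).pow 4).isBigO_one ℝ
  have := ((o3.mul theta2_pow4_isBigO).mul o4).const_mul_left ((π : ℂ) ^ 2 / 8)
  simp only [one_mul, mul_one] at this
  exact (EE_isBigO theta4_diff theta4_isBigO).sub this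

lemma div_exp_isBigO {f : ℂ → ℂ} (h : f =O[LL] fun z => Real.exp (-π * z.im)) :
    (fun z => f z / Complex.exp (π * Complex.I * z)) =O[LL] fun _ => (1 : ℝ) := by
  obtain ⟨C, hC⟩ := h.bound
  refine IsBigO.of_bound C ?_
  filter_upwards [hC] with z hz
  rw [norm_div, norm_exp_pi, div_le_iff₀ (Real.exp_pos _)]
  rw [Real.norm_of_nonneg (Real.exp_pos _).le] at hz
  simpa using hz

lemma prod_zero {τ : ℂ} (hτ : 0 < τ.im) : G2 τ * (G3 τ * G4 τ) = 0 := by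
  have h := aux_levelOne 5 (fun z => (G2 z * (G3 z * G4 z)) ^ 4) 0
    (by
      have h2 := G2_diff
      have h3 := G3_diff
      have h4 := G4_diff
      fun_prop)
    (by
      intro z hz
      have h4 := exp_quarter_pow4
      simp only [G2_T, G3_T, G4_T]
      generalize Complex.exp (π * Complex.I / 4) = w at *
      have h8 : w ^ 8 = 1 := by rw [show w ^ 8 = (w ^ 4) ^ 2 by ring, h4]; norm_num
      linear_combination ((G2 z * (G3 z * G4 z)) ^ 4) * h8)
    (by
      intro z hz
      have h8 := gg_pow8 z
      simp only [G2_S hz, G3_S hz, G4_S hz]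
      rw [show (gg z ^ 2 * z ^ 4 * G4 z * (gg z ^ 2 * z ^ 4 * G3 z * (gg z ^ 2 * z ^ 4 * G2 z))) ^ 4 =
        (gg z ^ 8) ^ 3 * z ^ 48 * (G2 z * (G3 z * G4 z)) ^ 4 by ring, h8]
      ring)
    (by
      have k : (fun z => K2 z ^ 4) =o[LL] fun _ => (1 : ℝ) := by
        rw [isLittleO_one_iff]
        simpa using K2_tendsto.pow 4
      have h : (fun z => K2 z ^ 4 * ((G3 z / Complex.exp (π * Complex.I * z)) ^ 4 *
          (G4 z / Complex.exp (π * Complex.I * z)) ^ 4)) =o[LL]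
          fun _ => (1 : ℝ) * ((1 : ℝ) ^ 4 * (1 : ℝ) ^ 4) :=
        k.mul_isBigO (((div_exp_isBigO G3_isBigO).pow 4).mul ((div_exp_isBigO G4_isBigO).pow 4))
      simp only [one_pow, mul_one] at h
      rw [isLittleO_one_iff] at h
      refine h.congr' ?_
      filter_upwards [eventually_HH] with z hz
      rw [G2_eq hz]
      have h1 : Complex.exp (2 * π * Complex.I * z) = Complex.exp (π * Complex.I / 4 * z) ^ 8 := by
        rw [← Complex.exp_nat_mul]
        congr 1
        push_cast
        ring
      have h2 : Complex.exp (π * Complex.I * z) = Complex.exp (π * Complex.I / 4 * z) ^ 4 := by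
        rw [← Complex.exp_nat_mul]
        congr 1
        push_cast
        ring
      rw [h1, h2]
      have hne := Complex.exp_ne_zero (π * Complex.I / 4 * z)
      generalize Complex.exp (π * Complex.I / 4 * z) = w at *
      field_simp)
    ⟨τ, hτ⟩
  simp only [zero_mul] at h
  exact pow_eq_zero_iff (by norm_num) |>.1 h

lemma G3_zero {τ : ℂ} (hτ : 0 < τ.im) : G3 τ = 0 := by
  have hpre : IsPreconnected HH := (convex_halfSpace_im_gt 0).isPreconnected
  have a2 := G2_diff.analyticOnNhd isOpen_HH
  have a3 := G3_diff.analyticOnNhd isOpen_HH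
  have a4 := G4_diff.analyticOnNhd isOpen_HH
  have h4 : (∀ z ∈ HH, G4 z = 0) → G3 τ = 0 := by
    intro h
    rw [← G4_T]
    exact h _ (by simpa using hτ)
  rcases a2.eq_zero_or_eq_zero_of_mul_eq_zero (a3.mul a4) (fun z hz => prod_zero hz) hpre with h | h
  · refine h4 fun z hz => ?_
    have h1 := h _ (neg_inv_mem hz)
    rw [G2_S hz] at h1
    simpa [gg_ne hz, ne_zero_of_mem hz] using h1
  · rcases a3.eq_zero_or_eq_zero_of_mul_eq_zero a4 h hpre with h | h
    · exact h _ hτ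
    · exact h4 h

/-- `(1/(2πi)) t' = 2t² - xy/32`; equivalently `πi A' = A² - (π⁴/4) xy`. -/
theorem derivative_of_t (τ : ℂ) (hτ : 0 < τ.im) :
    deriv tt τ / (2 * Real.pi * Complex.I)
        = 2 * (tt τ) ^ 2 - xx τ * yy τ / 32 ∧
    (Real.pi : ℂ) * Complex.I * deriv AA τ
        = (AA τ) ^ 2 - (Real.pi : ℂ) ^ 4 / 4 * (xx τ * yy τ) := by
  have hne := theta_ne hτ
  have hpi : (Real.pi : ℂ) ≠ 0 := by exact_mod_cast Real.pi_ne_zero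
  have d0 := (theta_diff.differentiableAt (isOpen_HH.mem_nhds hτ)).hasDerivAt
  have d1 := ((theta_diff.deriv isOpen_HH).differentiableAt (isOpen_HH.mem_nhds hτ)).hasDerivAt
  have hI := Complex.I_ne_zero
  have hg := G3_zero hτ
  have ht : HasDerivAt tt _ τ :=
    d1.div (d0.const_mul (2 * (Real.pi : ℂ) * Complex.I))
      (mul_ne_zero (mul_ne_zero (mul_ne_zero two_ne_zero hpi) hI) hne)
  have hA : deriv AA τ = -4 * (Real.pi : ℂ) ^ 2 * deriv tt τ := (ht.differentiableAt.hasDerivAt.const_mul _).deriv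
  have key : deriv tt τ / (2 * Real.pi * Complex.I) = 2 * (tt τ) ^ 2 - xx τ * yy τ / 32 := by
    rw [ht.deriv, tt, xx, yy]
    unfold G3 EE at hg
    have hI2 := Complex.I_sq
    generalize deriv (deriv theta) τ = a at *
    generalize deriv theta τ = b at *
    generalize theta τ = c at *
    rw [show a = (3 * b ^ 2 - π ^ 2 / 8 * (c ^ 2 * theta2 τ ^ 4 * theta4 τ ^ 4)) / c by
      rw [eq_div_iff hne]; linear_combination hg]
    field_simp
    simp only [hI2]
    ring
  refine ⟨key, ?_⟩
  have h2 : deriv tt τ = (2 * (tt τ) ^ 2 - xx τ * yy τ / 32) * (2 * Real.pi * Complex.I) := by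
    rw [← key]; field_simp
  rw [hA, h2, AA]
  linear_combination (-8 * (π : ℂ) ^ 4 * (2 * (tt τ) ^ 2 - xx τ * yy τ / 32)) * Complex.I_sq
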